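/- Fix d ≥ 2. For every p > 0 there exists ε > 0 such that for all sufficiently large n and m, for every x ∈ B[m] and every set S ⊆ B[m+n] with |S| ≤ ε b_n, the probability that a simple random walk started at x exits S ∪ B[m] through a point of ∂B[m+n] (i.e. that ξ(t_{S ∪ B[m]}) ∈ ∂B[m+n]) is at most p. -/

import Mathlib

open MeasureTheory Filter
open scoped ENNReal

noncomputable section

/-- The `k`-th binary digit of `x ∈ [0,1)` (after the binary point). -/
def bit (x : ℝ) (k : ℕ) : Bool := ⌊x * 2 ^ (k + 1)⌋ % 2 == 1

/-- From one uniform sample on `[0,1]`, extract countably many independent uniform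
samples on `[0,1]`, using disjoint subsequences of binary digits. -/
def uSlice (x : ℝ) (i : ℕ) : ℝ :=
  ∑' j : ℕ, if bit x (Nat.pair i j) then ((2 : ℝ) ^ (-(j : ℤ) - 1)) else 0

/-- The base probability space: Lebesgue measure restricted to `[0,1]`. -/
def μ0 : Measure ℝ := volume.restrict (Set.Icc 0 1)

/-- The vertex set of the lattice `ℤ^d`. -/
abbrev V (d : ℕ) := Fin d → ℤ

instance (d : ℕ) : MeasurableSpace (Finset (V d)) := ⊤

open Classical in
/-- `B[r]`: the Euclidean ball of radius `r` in `ℤ^d`, as a `Finset`. -/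
def ball (d : ℕ) (r : ℝ) : Finset (V d) :=
  (Finset.Icc (fun _ => -⌈r⌉) (fun _ => ⌈r⌉)).filter
    (fun y => Real.sqrt (∑ i, ((y i : ℝ)) ^ 2) ≤ r)

/-- `b_n`: the number of lattice points in the Euclidean ball of radius `n`. -/
def bn (d n : ℕ) : ℕ := (ball d n).card

/-- The `2d` unit vectors of `ℤ^d` (the possible steps of the simple random walk). -/
def unitVecs (d : ℕ) : Finset (V d) :=
  Finset.image
    (fun p : Fin d × Bool => fun j => if j = p.1 then (if p.2 then 1 else -1) else 0)
    Finset.univ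

/-- Given `u` uniform on `[0,1]`, `pick S u` is a uniformly chosen element of `S`. -/
def pick {d : ℕ} (S : Finset (V d)) (u : ℝ) : V d :=
  if h : S.Nonempty then
    (S.equivFin.symm ⟨(⌊u * S.card⌋).toNat % S.card,
      Nat.mod_lt _ (Finset.card_pos.mpr h)⟩).val
  else 0

/-- Position at time `t` of the simple random walk started at `x`, driven by the
random seed `ω`: the steps `pick (unitVecs d) (uSlice ω i)` are i.i.d. uniform on
the `2d` unit vectors when `ω` is uniform on `[0,1]`. -/
def walk {d : ℕ} (x : V d) (ω : ℝ) (t : ℕ) : V d :=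
  x + ∑ i ∈ Finset.range t, pick (unitVecs d) (uSlice ω i)

/-- `t_S`: the first time the walk started at `x` is outside `S`. -/
def exitT {d : ℕ} (S : Finset (V d)) (x : V d) (ω : ℝ) : ℕ :=
  sInf {t | walk x ω t ∉ S}

/-- The position `ξ(t_S)` at which the walk started at `x` first exits `S`. -/
def hitPt {d : ℕ} (S : Finset (V d)) (x : V d) (ω : ℝ) : V d :=
  walk x ω (exitT S x ω)

/-- `Add[ξ,S]`: add to `S` the exit point of a random walk started at `x`. -/
def addPt {d : ℕ} (S : Finset (V d)) (x : V d) (ω : ℝ) : Finset (V d) :=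
  insert (hitPt S x ω) S

/-- `P_x(ξ(τ_A) = y)`: the probability that the walk started at `x` exits `A` at `y`. -/
def hitProb {d : ℕ} (A : Finset (V d)) (x y : V d) : ℝ≥0∞ :=
  μ0 {ω | hitPt A x ω = y}

/-- The outer boundary `∂A`: vertices outside `A` with a neighbour in `A`. -/
def outb {d : ℕ} (A : Finset (V d)) : Finset (V d) :=
  (A.biUnion fun x => (unitVecs d).image (fun e => x + e)) \ A

/-- `DA_X(S)`: the IDLA aggregate obtained from `S` by launching one particle from each
point of the list `xs` in turn (driven by independent slices of the seed `ω`). -/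
def daFrom {d : ℕ} : Finset (V d) → List (V d) → ℝ → Finset (V d)
  | S, [], _ => S
  | S, x :: xs, ω => daFrom (addPt S x (uSlice ω 0)) xs (uSlice ω 1)

/-- The law of the IDLA aggregate `DA_X(S)`. -/
def daLaw {d : ℕ} (S : Finset (V d)) (xs : List (V d)) : Measure (Finset (V d)) :=
  μ0.map (fun ω => daFrom S xs ω)

/-- One uIDLA step: launch a particle from a uniformly chosen point of `S`. -/
def uStep {d : ℕ} (S : Finset (V d)) (ω : ℝ) : Finset (V d) :=
  addPt S (pick S (uSlice ω 0)) (uSlice ω 1)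

/-- `A_k(S)`: the uIDLA aggregate obtained by adding `k` particles to `S`,
each started at a uniform point of the current aggregate. -/
def uAggFrom {d : ℕ} (S : Finset (V d)) (ω : ℝ) : ℕ → Finset (V d)
  | 0 => S
  | k + 1 => uStep (uAggFrom S ω k) (uSlice ω k)

/-- The law of the uIDLA aggregate `A_k(S)`. -/
def uLaw {d : ℕ} (S : Finset (V d)) (k : ℕ) : Measure (Finset (V d)) :=
  μ0.map (fun ω => uAggFrom S ω k)

/-- One step of the subset uIDLA `A_·(E;m)`: at step `k`, perform a uIDLA step
with probability `|E|/(m+k)` and otherwise do nothing. -/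
def subStep {d : ℕ} (m k : ℕ) (E : Finset (V d)) (ω : ℝ) : Finset (V d) :=
  if uSlice ω 0 * ((m : ℝ) + k) ≤ E.card then uStep E (uSlice ω 1) else E

/-- The subset uIDLA `A_n(E;m)`. -/
def subAggFrom {d : ℕ} (E : Finset (V d)) (m : ℕ) (ω : ℝ) : ℕ → Finset (V d)
  | 0 => E
  | k + 1 => subStep m k (subAggFrom E m ω k) (uSlice ω k)

/-- The law of the subset uIDLA `A_n(E;m)`. -/
def subLaw {d : ℕ} (E : Finset (V d)) (m k : ℕ) : Measure (Finset (V d)) :=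
  μ0.map (fun ω => subAggFrom E m ω k)

/-- Stochastic domination of random finite subsets of `ℤ^d`: `μ` dominates `ν` if
there is a coupling under which the sample of `ν` is a.s. contained in that of `μ`. -/
def StochDom {d : ℕ} (μ ν : Measure (Finset (V d))) : Prop :=
  ∃ π : Measure (Finset (V d) × Finset (V d)), IsProbabilityMeasure π ∧
    π.map Prod.fst = μ ∧ π.map Prod.snd = ν ∧ π {p | p.2 ⊆ p.1} = 1

/-- A `Geometric(1/2)` sample (taking value `j ≥ 0` with probability `2^{-(j+1)}`)
produced from a uniform sample `u` on `[0,1]` by inverting the CDF. -/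
def geom (u : ℝ) : ℕ := sInf {j : ℕ | u ≤ 1 - (2 : ℝ) ^ (-(j : ℤ) - 1)}

/-- The parent of vertex `j ≥ 1` in the uniform random recursive tree (vertex `0` is
the root): uniform on `{0, …, j-1}` when the seed is uniform on `[0,1]`. -/
def parent (ω : ℝ) (j : ℕ) : ℕ := (⌊uSlice ω (Nat.pair 0 j) * j⌋).toNat % j

/-- The reaching time of vertex `j` in a uniform random recursive tree whose edges
carry i.i.d. `Geometric(1/2)` weights: the sum of the weights on the path from the
root to `j`. (The `min` is a.s. inoperative, since a.s. `parent ω (j+1) ≤ j`.) -/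
def reach (ω : ℝ) : ℕ → ℕ
  | 0 => 0
  | j + 1 => reach ω (min (parent ω (j + 1)) j) + geom (uSlice ω (Nat.pair 1 (j + 1)))
termination_by j => j
decreasing_by exact Nat.lt_succ_of_le (min_le_right _ _)

end



/-! ### Part A: the driving steps are i.i.d. uniform -/

noncomputable def fairBit : Measure Bool := (2⁻¹ : ℝ≥0∞) • Measure.dirac true + (2⁻¹ : ℝ≥0∞) • Measure.dirac false

instance fairBit_prob : IsProbabilityMeasure fairBit := by
  constructor
  simp [fairBit, ENNReal.inv_two_add_inv_two]

instance mu0_prob : IsProbabilityMeasure μ0 := by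
  constructor
  simp [μ0]

theorem fairBit_singleton (b : Bool) : fairBit {b} = 2⁻¹ := by
  cases b <;> simp [fairBit]

theorem measurable_bit (k : ℕ) : Measurable (fun ω : ℝ => bit ω k) := by
  unfold bit
  have h1 : Measurable (fun ω : ℝ => ⌊ω * 2 ^ (k + 1)⌋) := by fun_prop
  exact (measurable_from_top (f := fun z : ℤ => (z % 2 == 1))).comp h1

theorem floor_succ_eq (ω : ℝ) (L : ℕ) :
    ⌊ω * 2 ^ (L + 1)⌋ = 2 * ⌊ω * 2 ^ L⌋ + (if bit ω L then 1 else 0) := by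
  have h : ⌊ω * 2 ^ L⌋ = ⌊ω * 2 ^ (L + 1)⌋ / 2 := by
    have := Int.floor_div_natCast (k := ℝ) (ω * 2 ^ (L + 1)) 2
    rw [show ω * 2 ^ L = ω * 2 ^ (L+1) / (2:ℕ) by push_cast; ring]
    simpa using this
  rw [h]
  unfold bit
  by_cases hb : ⌊ω * 2 ^ (L + 1)⌋ % 2 = 1
  · simp [hb]; omega
  · simp [hb]; omega

theorem floor_eq_of_bits (v : ℕ → Bool) (L : ℕ) :
    ∃ q : ℤ, ∀ ω ∈ Set.Ico (0:ℝ) 1, (∀ k < L, bit ω k = v k) → ⌊ω * 2 ^ L⌋ = q := by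
  induction L with
  | zero =>
    refine ⟨0, fun ω hω _ => ?_⟩
    simp [Int.floor_eq_zero_iff, hω.1, hω.2]
  | succ L ih =>
    obtain ⟨q, hq⟩ := ih
    refine ⟨2 * q + (if v L then 1 else 0), fun ω hω h => ?_⟩
    rw [floor_succ_eq, hq ω hω (fun k hk => h k (by omega)), h L (by omega)]

theorem bits_le (v : ℕ → Bool) (L : ℕ) :
    μ0 {ω | ∀ k < L, bit ω k = v k} ≤ (2⁻¹ : ℝ≥0∞) ^ L := by
  obtain ⟨q, hq⟩ := floor_eq_of_bits v L
  have hpos : (0:ℝ) < 2 ^ L := by positivity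
  have hsub : {ω | ∀ k < L, bit ω k = v k} ∩ Set.Icc 0 1 ⊆
      Set.Ico ((q:ℝ) / 2 ^ L) ((q + 1) / 2 ^ L) ∪ {1} := by
    rintro ω ⟨h, h0, h1⟩
    rcases h1.lt_or_eq with h1 | h1
    · left
      have := hq ω ⟨h0, h1⟩ h
      rw [Int.floor_eq_iff] at this
      constructor
      · rw [div_le_iff₀ hpos]; exact this.1
      · rw [lt_div_iff₀ hpos]; exact this.2
    · right; exact h1
  have hm : MeasurableSet {ω | ∀ k < L, bit ω k = v k} := by
    have : {ω | ∀ k < L, bit ω k = v k} = ⋂ k, ⋂ (_ : k < L), {ω | bit ω k = v k} := by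
      ext; simp
    rw [this]
    refine MeasurableSet.iInter fun k => MeasurableSet.iInter fun _ => ?_
    exact measurable_bit k (measurableSet_singleton (v k))
  unfold μ0
  rw [Measure.restrict_apply hm]
  refine (measure_mono hsub).trans ((measure_union_le _ _).trans ?_)
  rw [Real.volume_Ico, Real.volume_singleton, add_zero]
  rw [show ((q:ℝ) + 1) / 2 ^ L - q / 2 ^ L = (2⁻¹) ^ L by
    rw [inv_pow]; field_simp; ring]
  rw [ENNReal.ofReal_pow (by norm_num), ENNReal.ofReal_inv_of_pos (by norm_num)]
  simp

theorem map_bits_fin (L : ℕ) :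
    μ0.map (fun ω (k : Fin L) => bit ω k) = Measure.pi (fun _ : Fin L => fairBit) := by
  have hmeas : Measurable (fun ω (k : Fin L) => bit ω k) :=
    measurable_pi_lambda _ fun k => measurable_bit k
  have : IsProbabilityMeasure (μ0.map (fun ω (k : Fin L) => bit ω k)) :=
    Measure.isProbabilityMeasure_map hmeas.aemeasurable
  refine Measure.eq_of_le_of_isProbabilityMeasure ?_
  refine Measure.le_iff.2 fun s _ => ?_
  have key : ∀ v : Fin L → Bool, μ0.map (fun ω (k : Fin L) => bit ω k) {v} ≤
      Measure.pi (fun _ : Fin L => fairBit) {v} := by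
    intro v
    rw [Measure.pi_singleton, Measure.map_apply hmeas (measurableSet_singleton v)]
    simp only [fairBit_singleton, Finset.prod_const, Finset.card_univ, Fintype.card_fin]
    refine (measure_mono ?_).trans (bits_le (fun k => if h : k < L then v ⟨k, h⟩ else false) L)
    intro ω hω k hk
    simp only [Set.mem_preimage, Set.mem_singleton_iff] at hω
    simp [hk, ← hω]
  have hs : s = ⋃ v ∈ s, {v} := by simp
  have hf : s.Finite := Set.toFinite s
  have e1 : ∀ ν : Measure (Fin L → Bool), ν s = ∑ v ∈ hf.toFinset, ν {v} := by
    intro ν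
    rw [sum_measure_singleton]
    simp
  rw [e1, e1]
  exact Finset.sum_le_sum fun v _ => key v

theorem map_bits : μ0.map (fun ω k => bit ω k) = Measure.infinitePi (fun _ : ℕ => fairBit) := by
  classical
  have hmeas : Measurable (fun ω k => bit ω k) :=
    measurable_pi_lambda _ fun k => measurable_bit k
  refine Measure.eq_infinitePi _ fun s t ht => ?_
  obtain ⟨L, hL⟩ : ∃ L, s ⊆ Finset.range L := ⟨s.sup id + 1, fun k hk => by
    simp only [Finset.mem_range]
    exact Nat.lt_succ_of_le (Finset.le_sup (f := id) hk)⟩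
  have hmeasL : Measurable (fun ω (k : Fin L) => bit ω k) :=
    measurable_pi_lambda _ fun k => measurable_bit k
  set t' : Fin L → Set Bool := fun k => if (k : ℕ) ∈ s then t k else Set.univ with ht'
  have hpre : (fun ω k => bit ω k) ⁻¹' (Set.pi s t) =
      (fun ω (k : Fin L) => bit ω k) ⁻¹' (Set.univ.pi t') := by
    ext ω
    simp only [Set.mem_preimage, Set.mem_pi, Finset.mem_coe, Set.mem_univ, true_imp_iff, ht']
    constructor
    · intro h k
      split_ifs with hk
      · exact h k hk
      · trivial
    · intro h k hk
      have := h ⟨k, Finset.mem_range.1 (hL hk)⟩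
      simpa [hk] using this
  rw [Measure.map_apply hmeas (MeasurableSet.pi s.countable_toSet fun i _ => ht i), hpre,
    ← Measure.map_apply hmeasL (MeasurableSet.of_discrete), map_bits_fin, Measure.pi_pi,
    Fin.prod_univ_eq_prod_range (fun k => fairBit (if k ∈ s then t k else Set.univ)) L,
    ← Finset.prod_subset hL]
  · exact Finset.prod_congr rfl fun k hk => by simp [hk]
  · intro k _ hk
    rw [if_neg hk]; exact measure_univ

theorem map_rows : μ0.map (fun ω i j => bit ω (Nat.pair i j)) =
    Measure.infinitePi (fun _ : ℕ => Measure.infinitePi (fun _ : ℕ => fairBit)) := by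
  have hmeas : Measurable (fun ω k => bit ω k) :=
    measurable_pi_lambda _ fun k => measurable_bit k
  have h1 := Measure.map_infinitePi_infinitePi_of_inj (P := fun _ : ℕ => fairBit)
    (f := fun p : ℕ × ℕ => Nat.pair p.1 p.2) Nat.pairEquiv.injective
  have h2 := Measure.infinitePi_map_curry (ι := ℕ) (κ := ℕ) (X := Bool) (fun _ _ => fairBit)
  rw [← h2, ← h1, ← map_bits, Measure.map_map (by fun_prop) hmeas,
    Measure.map_map (by fun_prop) (by fun_prop)]
  rfl

/-- Assemble a real number from its binary digits. -/
noncomputable def fromBits (b : ℕ → Bool) : ℝ :=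
  ∑' j : ℕ, if b j then ((2 : ℝ) ^ (-(j : ℤ) - 1)) else 0

theorem measurable_fromBits : Measurable fromBits := by
  unfold fromBits
  have : ∀ b : ℕ → Bool, Summable (fun j : ℕ => if b j then ((2 : ℝ) ^ (-(j : ℤ) - 1)) else 0) := by
    intro b
    refine Summable.of_nonneg_of_le (f := fun j : ℕ => (1/2:ℝ) ^ j) ?_ ?_ summable_geometric_two
    · intro j; split_ifs <;> positivity
    · intro j
      split_ifs
      · rw [sub_eq_add_neg, zpow_add₀ (by norm_num), zpow_neg, zpow_natCast, one_div, inv_pow]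
        have : (0:ℝ) < (2^j)⁻¹ := by positivity
        norm_num
      · positivity
  refine measurable_of_tendsto_metrizable (f := fun n (b : ℕ → Bool) => ∑ j ∈ Finset.range n,
    if b j then ((2 : ℝ) ^ (-(j : ℤ) - 1)) else 0) ?_ ?_
  · intro n
    refine Finset.measurable_fun_sum _ fun j _ => ?_
    exact (measurable_from_top (f := fun c : Bool => if c then ((2 : ℝ) ^ (-(j : ℤ) - 1)) else 0)).comp
      (measurable_pi_apply j)
  · rw [tendsto_pi_nhds]
    intro b
    exact (this b).hasSum.tendsto_sum_nat

theorem fromBits_bit (x : ℝ) (hx : x ∈ Set.Ico (0:ℝ) 1) : fromBits (fun k => bit x k) = x := by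
  conv_rhs => rw [← Real.ofDigits_digits (b := 2) (by norm_num) hx]
  unfold fromBits Real.ofDigits Real.ofDigitsTerm Real.digits bit
  refine tsum_congr fun j => ?_
  have h0 : 0 ≤ x * 2 ^ (j+1) := mul_nonneg hx.1 (by positivity)
  have hf : (⌊x * 2 ^ (j+1)⌋ : ℤ) = (⌊x * 2 ^ (j+1)⌋₊ : ℤ) := (Int.natCast_floor_eq_floor h0).symm
  beta_reduce
  rw [hf]
  push_cast
  generalize ⌊x * 2 ^ (j+1)⌋₊ = q
  rw [show (-(j:ℤ) - 1) = -((j+1 : ℕ):ℤ) by push_cast; ring, zpow_neg, zpow_natCast]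
  rcases Nat.mod_two_eq_zero_or_one q with h | h
  · have : (q:ℤ) % 2 = 0 := by omega
    simp [h, this, Fin.val_ofNat]
  · have : (q:ℤ) % 2 = 1 := by omega
    simp [h, this, Fin.val_ofNat]

theorem card_unitVecs (d : ℕ) : (unitVecs d).card = 2 * d := by
  unfold unitVecs
  rw [Finset.card_image_of_injective]
  · simp [mul_comm]
  · rintro ⟨i, a⟩ ⟨j, b⟩ h
    have h1 := congrFun h i
    simp only [if_true] at h1
    by_cases hij : i = j
    · subst hij
      cases a <;> cases b <;> simp at h1 ⊢
    · rw [if_neg hij] at h1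
      cases a <;> simp at h1

theorem measurable_pick {d : ℕ} (S : Finset (V d)) : Measurable (pick S) := by
  have h1 : Measurable (fun u : ℝ => ⌊u * S.card⌋) := by fun_prop
  unfold pick
  by_cases h : S.Nonempty
  · simp only [h, dite_true]
    exact (measurable_from_top (f := fun z : ℤ => (S.equivFin.symm ⟨z.toNat % S.card,
      Nat.mod_lt _ (Finset.card_pos.mpr h)⟩).val)).comp h1
  · simp only [h, dite_false]; exact measurable_const

theorem pick_mem {d : ℕ} (S : Finset (V d)) (h : S.Nonempty) (u : ℝ) : pick S u ∈ S := by
  simp [pick, h]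

theorem pick_le {d : ℕ} (S : Finset (V d)) (h : S.Nonempty) (e : V d) :
    μ0 {u | pick S u = e} ≤ (S.card : ℝ≥0∞)⁻¹ := by
  by_cases he : e ∈ S
  swap
  · have : {u | pick S u = e} = ∅ := by
      ext u; simp only [Set.mem_ofPred_eq, Set.mem_empty_iff_false, iff_false]
      rintro rfl; exact he (pick_mem S h u)
    simp [this]
  have hc : (0:ℝ) < S.card := by exact_mod_cast Finset.card_pos.mpr h
  set a : ℕ := (S.equivFin ⟨e, he⟩ : ℕ)
  have hm : MeasurableSet {u | pick S u = e} := measurable_pick S (measurableSet_singleton e)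
  have hsub : {u | pick S u = e} ∩ Set.Icc 0 1 ⊆
      Set.Ico ((a:ℝ) / S.card) ((a + 1) / S.card) ∪ {1} := by
    rintro u ⟨hu, h0, h1⟩
    rcases h1.lt_or_eq with h1 | h1
    swap
    · right; exact h1
    left
    have hu' : S.equivFin.symm ⟨(⌊u * S.card⌋).toNat % S.card,
      Nat.mod_lt _ (Finset.card_pos.mpr h)⟩ = ⟨e, he⟩ := by
      apply Subtype.ext
      simpa [pick, h] using hu
    rw [Equiv.symm_apply_eq] at hu'
    have hu2 : (⌊u * S.card⌋).toNat % S.card = a := congrArg Fin.val hu'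
    have hn : 0 ≤ ⌊u * S.card⌋ := Int.floor_nonneg.2 (by positivity)
    have hlt : ⌊u * S.card⌋ < S.card := by
      rw [Int.floor_lt]; push_cast; nlinarith
    rw [Nat.mod_eq_of_lt (by omega)] at hu2
    have : ⌊u * S.card⌋ = (a:ℤ) := by omega
    rw [Int.floor_eq_iff] at this
    push_cast at this
    exact ⟨by rw [div_le_iff₀ hc]; exact this.1, by rw [lt_div_iff₀ hc]; exact this.2⟩
  unfold μ0
  rw [Measure.restrict_apply hm]
  refine (measure_mono hsub).trans ((measure_union_le _ _).trans ?_)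
  rw [Real.volume_Ico, Real.volume_singleton, add_zero]
  rw [show ((a:ℝ) + 1) / S.card - a / S.card = (S.card:ℝ)⁻¹ by field_simp; ring]
  rw [ENNReal.ofReal_inv_of_pos hc]
  simp

theorem steps_le {d : ℕ} (S : Finset (V d)) (h : S.Nonempty) (e : ℕ → V d) (k : ℕ) :
    μ0 {ω | ∀ i < k, pick S (uSlice ω i) = e i} ≤ ((S.card : ℝ≥0∞)⁻¹) ^ k := by
  have hmeas : Measurable (fun ω k => bit ω k) :=
    measurable_pi_lambda _ fun k => measurable_bit k
  have hmeas2 : Measurable (fun ω i j => bit ω (Nat.pair i j)) :=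
    measurable_pi_lambda _ fun i => measurable_pi_lambda _ fun j => measurable_bit _
  set C : ℕ → Set (ℕ → Bool) := fun i => {b | pick S (fromBits b) = e i} with hC
  have hCm : ∀ i, MeasurableSet (C i) := fun i =>
    ((measurable_pick S).comp measurable_fromBits) (measurableSet_singleton (e i))
  have hset : {ω | ∀ i < k, pick S (uSlice ω i) = e i} =
      (fun ω i j => bit ω (Nat.pair i j)) ⁻¹' (Set.pi (Finset.range k : Finset ℕ) C) := by
    ext ω
    simp [hC, uSlice, fromBits]
  rw [hset, ← Measure.map_apply hmeas2
    (MeasurableSet.pi (Finset.range k).countable_toSet fun i _ => hCm i), map_rows,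
    Measure.infinitePi_pi _ (fun i _ => hCm i)]
  calc ∏ i ∈ Finset.range k, Measure.infinitePi (fun _ : ℕ => fairBit) (C i)
      ≤ ∏ i ∈ Finset.range k, (S.card : ℝ≥0∞)⁻¹ := by
        refine Finset.prod_le_prod' fun i _ => ?_
        rw [← map_bits, Measure.map_apply hmeas (hCm i)]
        refine le_trans ?_ (pick_le S h (e i))
        refine measure_mono_ae ?_
        have h01 : ∀ᵐ ω ∂μ0, ω ∈ Set.Ico (0:ℝ) 1 := by
          unfold μ0
          rw [← Measure.restrict_congr_set Ico_ae_eq_Icc]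
          exact ae_restrict_mem measurableSet_Ico
        filter_upwards [h01] with ω hω hmem
        have : pick S (fromBits (fun k => bit ω k)) = e i := hmem
        rw [fromBits_bit ω hω] at this
        exact this
    _ = _ := by simp


/-! ### Part B: reduction to a deterministic recursion -/

/-- Average of `f` over the `2d` neighbours. -/
noncomputable def nbrAvg {d : ℕ} (f : V d → ℝ) (x : V d) : ℝ :=
  (∑ e ∈ unitVecs d, f (x + e)) / (2 * d)

open Classical in
/-- Probability that the walk from `x` exits `A` in `tgt` within `T` steps. -/
noncomputable def hitQ {d : ℕ} (A tgt : Finset (V d)) : ℕ → V d → ℝ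
  | 0, x => if x ∈ A then 0 else if x ∈ tgt then 1 else 0
  | T + 1, x => if x ∈ A then nbrAvg (hitQ A tgt T) x else if x ∈ tgt then 1 else 0

theorem nbrAvg_mono {d : ℕ} {f g : V d → ℝ} (h : ∀ z, f z ≤ g z) (x : V d) :
    nbrAvg f x ≤ nbrAvg g x := by
  unfold nbrAvg
  gcongr with e he
  exact h _

theorem nbrAvg_const {d : ℕ} (hd : 0 < d) (c : ℝ) (x : V d) :
    nbrAvg (fun _ => c) x = c := by
  unfold nbrAvg
  have : (d:ℝ) ≠ 0 := by positivity
  rw [Finset.sum_const, card_unitVecs]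
  simp
  field_simp

theorem nbrAvg_nonneg {d : ℕ} {f : V d → ℝ} (h : ∀ z, 0 ≤ f z) (x : V d) : 0 ≤ nbrAvg f x :=
  div_nonneg (Finset.sum_nonneg fun _ _ => h _) (by positivity)

theorem hitQ_nonneg {d : ℕ} (A tgt : Finset (V d)) (T : ℕ) (x : V d) : 0 ≤ hitQ A tgt T x := by
  induction T generalizing x with
  | zero => unfold hitQ; split_ifs <;> norm_num
  | succ T ih =>
    unfold hitQ
    split_ifs
    · exact nbrAvg_nonneg ih x
    · norm_num
    · norm_num

theorem hitQ_le_one {d : ℕ} (hd : 0 < d) (A tgt : Finset (V d)) (T : ℕ) (x : V d) :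
    hitQ A tgt T x ≤ 1 := by
  induction T generalizing x with
  | zero => unfold hitQ; split_ifs <;> norm_num
  | succ T ih =>
    unfold hitQ
    split_ifs
    · exact (nbrAvg_mono ih x).trans (nbrAvg_const hd 1 x).le
    · norm_num
    · norm_num

theorem hitQ_mono {d : ℕ} (A tgt : Finset (V d)) (T : ℕ) (x : V d) :
    hitQ A tgt T x ≤ hitQ A tgt (T + 1) x := by
  induction T generalizing x with
  | zero =>
    unfold hitQ
    split_ifs
    · exact nbrAvg_nonneg (hitQ_nonneg A tgt 0) x
    · norm_num
    · norm_num
  | succ T ih =>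
    rw [hitQ, hitQ]
    split_ifs
    · exact nbrAvg_mono ih x
    · norm_num
    · norm_num

theorem hitQ_of_not_mem {d : ℕ} (A tgt : Finset (V d)) (T : ℕ) (x : V d) (hA : x ∉ A)
    (ht : x ∉ tgt) : hitQ A tgt T x = 0 := by
  cases T <;> simp [hitQ, hA, ht]

theorem hitQ_of_mem_tgt {d : ℕ} (A tgt : Finset (V d)) (T : ℕ) (x : V d) (hA : x ∉ A)
    (ht : x ∈ tgt) : hitQ A tgt T x = 1 := by
  cases T <;> simp [hitQ, hA, ht]

theorem hitQ_subharm {d : ℕ} (A tgt : Finset (V d)) (T : ℕ) (x : V d) (ht : x ∉ tgt) :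
    hitQ A tgt T x ≤ nbrAvg (hitQ A tgt T) x := by
  by_cases hA : x ∈ A
  · refine (hitQ_mono A tgt T x).trans ?_
    rw [hitQ, if_pos hA]
  · rw [hitQ_of_not_mem A tgt T x hA ht]
    exact nbrAvg_nonneg (hitQ_nonneg A tgt T) x

theorem unitVecs_nonempty {d : ℕ} (hd : 0 < d) : (unitVecs d).Nonempty := by
  rw [← Finset.card_pos, card_unitVecs]; omega

/-- The event bounding the exit through `tgt` in `T` further steps after `k` prescribed ones. -/
def hitEv {d : ℕ} (A tgt : Finset (V d)) (x : V d) (e : ℕ → V d) (k T : ℕ) : Set ℝ :=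
  {ω | (∀ i < k, pick (unitVecs d) (uSlice ω i) = e i) ∧
    ∃ t ≤ T, walk x ω (k + t) ∉ A ∧ walk x ω (k + t) ∈ tgt ∧ ∀ s < t, walk x ω (k + s) ∈ A}

theorem hitEv_le {d : ℕ} (hd : 0 < d) (A tgt : Finset (V d)) (x : V d) (T : ℕ) :
    ∀ (k : ℕ) (e : ℕ → V d), μ0 (hitEv A tgt x e k T) ≤
      ENNReal.ofReal (hitQ A tgt T (x + ∑ i ∈ Finset.range k, e i)) * ((2 * d : ℝ≥0∞)⁻¹) ^ k := by
  have hcyl : ∀ (k : ℕ) (e : ℕ → V d), μ0 {ω | ∀ i < k, pick (unitVecs d) (uSlice ω i) = e i}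
      ≤ ((2 * d : ℝ≥0∞)⁻¹) ^ k := by
    intro k e
    have := steps_le (unitVecs d) (unitVecs_nonempty hd) e k
    rw [card_unitVecs] at this
    exact_mod_cast this
  have hwalk : ∀ (k : ℕ) (e : ℕ → V d) (ω : ℝ),
      (∀ i < k, pick (unitVecs d) (uSlice ω i) = e i) →
      walk x ω k = x + ∑ i ∈ Finset.range k, e i := by
    intro k e ω h
    unfold walk
    congr 1
    exact Finset.sum_congr rfl fun i hi => h i (Finset.mem_range.1 hi)
  have hout : ∀ (T k : ℕ) (e : ℕ → V d), x + ∑ i ∈ Finset.range k, e i ∉ A →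
      μ0 (hitEv A tgt x e k T) ≤
      ENNReal.ofReal (hitQ A tgt T (x + ∑ i ∈ Finset.range k, e i)) * ((2 * d : ℝ≥0∞)⁻¹) ^ k := by
    intro T k e hA
    by_cases ht : x + ∑ i ∈ Finset.range k, e i ∈ tgt
    · rw [hitQ_of_mem_tgt A tgt T _ hA ht]
      simp only [ENNReal.ofReal_one, one_mul]
      exact (measure_mono fun ω hω => hω.1).trans (hcyl k e)
    · have : hitEv A tgt x e k T = ∅ := by
        ext ω
        simp only [Set.mem_empty_iff_false, iff_false]
        rintro ⟨h1, t, htT, h2, h3, h4⟩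
        rcases Nat.eq_zero_or_pos t with rfl | htp
        · rw [add_zero, hwalk k e ω h1] at h3; exact ht h3
        · have := h4 0 htp
          rw [add_zero, hwalk k e ω h1] at this; exact hA this
      simp [this]
  induction T with
  | zero =>
    intro k e
    by_cases hA : x + ∑ i ∈ Finset.range k, e i ∈ A
    · have : hitEv A tgt x e k 0 = ∅ := by
        ext ω
        simp only [Set.mem_empty_iff_false, iff_false]
        rintro ⟨h1, t, htT, h2, h3, h4⟩
        obtain rfl : t = 0 := by omega
        rw [add_zero, hwalk k e ω h1] at h2; exact h2 hA
      simp [this]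
    · exact hout 0 k e hA
  | succ T ih =>
    intro k e
    by_cases hA : x + ∑ i ∈ Finset.range k, e i ∈ A
    swap
    · exact hout (T+1) k e hA
    have hsub : hitEv A tgt x e k (T+1) ⊆
        ⋃ e' ∈ unitVecs d, hitEv A tgt x (Function.update e k e') (k+1) T := by
      rintro ω ⟨h1, t, htT, h2, h3, h4⟩
      have hmem := pick_mem (unitVecs d) (unitVecs_nonempty hd) (uSlice ω k)
      refine Set.mem_biUnion hmem ⟨?_, ?_⟩
      · intro i hi
        rcases Nat.lt_succ_iff_lt_or_eq.1 hi with hi | rfl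
        · rw [Function.update_of_ne (by omega)]; exact h1 i hi
        · simp
      · rcases t with _ | t
        · rw [add_zero, hwalk k e ω h1] at h2; exact absurd hA h2
        refine ⟨t, by omega, ?_, ?_, ?_⟩
        · rw [show k + 1 + t = k + (t+1) by ring]; exact h2
        · rw [show k + 1 + t = k + (t+1) by ring]; exact h3
        · intro s hs
          rw [show k + 1 + s = k + (s+1) by ring]; exact h4 _ (by omega)
    refine (measure_mono hsub).trans ((measure_biUnion_finset_le _ _).trans ?_)
    have hstep : ∀ e' : V d, x + ∑ i ∈ Finset.range (k+1), Function.update e k e' i =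
        x + ∑ i ∈ Finset.range k, e i + e' := by
      intro e'
      rw [Finset.sum_range_succ, Function.update_self, add_assoc]
      congr 2
      exact Finset.sum_congr rfl fun i hi => by
        rw [Function.update_of_ne (by have := Finset.mem_range.1 hi; omega)]
    refine (Finset.sum_le_sum fun e' _ => ih (k+1) (Function.update e k e')).trans ?_
    simp only [hstep]
    rw [← Finset.sum_mul, ← ENNReal.ofReal_sum_of_nonneg (fun _ _ => hitQ_nonneg _ _ _ _),
      hitQ, if_pos hA, nbrAvg, ENNReal.ofReal_div_of_pos (by positivity), pow_succ', ← mul_assoc,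
      div_eq_mul_inv]
    apply le_of_eq
    congr 3
    rw [ENNReal.ofReal_mul (by norm_num)]
    simp

theorem prob_le_of_hitQ {d : ℕ} (hd : 0 < d) (A tgt : Finset (V d)) (x : V d) (p : ℝ)
    (hx : x ∉ tgt) (h : ∀ T, hitQ A tgt T x ≤ p) :
    μ0 {ω | hitPt A x ω ∈ tgt} ≤ ENNReal.ofReal p := by
  have hsub : {ω | hitPt A x ω ∈ tgt} ⊆ ⋃ T, hitEv A tgt x (fun _ => 0) 0 T := by
    intro ω hω
    have hω : hitPt A x ω ∈ tgt := hω
    rw [Set.mem_iUnion]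
    unfold hitPt exitT at hω
    by_cases hne : {t | walk x ω t ∉ A}.Nonempty
    · refine ⟨sInf {t | walk x ω t ∉ A}, by simp, _, le_rfl, ?_, ?_, ?_⟩
      · rw [zero_add]; exact Nat.sInf_mem hne
      · rw [zero_add]; exact hω
      · intro s hs
        rw [zero_add]
        have := Nat.notMem_of_lt_sInf hs
        simpa using this
    · rw [Set.not_nonempty_iff_eq_empty.1 hne, Nat.sInf_empty] at hω
      exact absurd (by simpa [walk] using hω) hx
  refine (measure_mono hsub).trans ?_
  have hmono : Monotone (fun T => hitEv A tgt x (fun _ => 0) 0 T) := by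
    rintro T T' hT ω ⟨h1, t, ht, h2⟩
    exact ⟨h1, t, ht.trans hT, h2⟩
  rw [hmono.measure_iUnion]
  refine iSup_le fun T => ?_
  refine (hitEv_le hd A tgt x T 0 (fun _ => 0)).trans ?_
  simp only [Finset.range_zero, Finset.sum_empty, add_zero, pow_zero, mul_one]
  exact ENNReal.ofReal_le_ofReal (h T)


/-! ### Part C: heat kernel estimate -/

theorem nbrAvg_eq {d : ℕ} (f : V d → ℝ) (x : V d) :
    nbrAvg f x = (∑ i : Fin d, (f (x + Pi.single i 1) + f (x + Pi.single i (-1))) / 2) / d := by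
  unfold nbrAvg unitVecs
  rw [Finset.sum_image]
  · rw [Fintype.sum_prod_type]
    have h : ∀ i : Fin d, ∀ c : ℤ, (fun j => if j = i then c else 0) = (Pi.single i c : V d) := by
      intro i c; ext j; simp [Pi.single_apply]
    simp only [Fintype.sum_bool, if_true, h, Bool.false_eq_true, if_false]
    rw [← Finset.sum_div, div_div]
  · rintro ⟨i, a⟩ _ ⟨j, b⟩ _ h
    have h1 := congrFun h i
    simp only [if_true] at h1
    by_cases hij : i = j
    · subst hij
      cases a <;> cases b <;> simp at h1 ⊢
    · rw [if_neg hij] at h1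
      cases a <;> simp at h1

/-- The law of the one dimensional simple random walk. -/
noncomputable def srwOne : ℕ → ℤ → ℝ
  | 0, j => if j = 0 then 1 else 0
  | k + 1, j => (srwOne k (j + 1) + srwOne k (j - 1)) / 2

theorem srwOne_nonneg (k : ℕ) (j : ℤ) : 0 ≤ srwOne k j := by
  induction k generalizing j with
  | zero => unfold srwOne; split_ifs <;> norm_num
  | succ k ih => unfold srwOne; have := ih (j+1); have := ih (j-1); positivity

theorem srwOne_sum_le (k : ℕ) (J : Finset ℤ) : ∑ j ∈ J, srwOne k j ≤ 1 := by
  induction k generalizing J with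
  | zero =>
    unfold srwOne
    rw [Finset.sum_ite_eq']
    split_ifs <;> norm_num
  | succ k ih =>
    unfold srwOne
    rw [← Finset.sum_div, Finset.sum_add_distrib]
    have h1 := ih (J.map (addRightEmbedding 1))
    have h2 := ih (J.map (addRightEmbedding (-1)))
    simp only [Finset.sum_map, addRightEmbedding_apply] at h1 h2
    simp only [← sub_eq_add_neg] at h2
    linarith

theorem srwOne_zero_of_lt (k : ℕ) (j : ℤ) (h : j < -(k:ℤ)) : srwOne k j = 0 := by
  induction k generalizing j with
  | zero => unfold srwOne; rw [if_neg (by simp at h; omega)]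
  | succ k ih =>
    unfold srwOne
    push_cast at h
    rw [ih _ (by omega), ih _ (by omega)]; simp

theorem srwOne_zero_of_odd (k : ℕ) (j : ℤ) (h : (j + k) % 2 = 1) : srwOne k j = 0 := by
  induction k generalizing j with
  | zero => unfold srwOne; rw [if_neg (by simp at h; omega)]
  | succ k ih =>
    unfold srwOne
    push_cast at h
    rw [ih _ (by omega), ih _ (by omega)]; simp

theorem srwOne_choose (k i : ℕ) : srwOne k (2 * i - k) = (k.choose i : ℝ) / 2 ^ k := by
  induction k generalizing i with
  | zero =>
    unfold srwOne
    rcases i with _ | i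
    · simp
    · rw [if_neg (by push_cast; omega)]; simp
  | succ k ih =>
    unfold srwOne
    rcases i with _ | i
    · have h1 := ih 0
      rw [srwOne_zero_of_lt k (2 * ((0:ℕ):ℤ) - ((k+1 : ℕ):ℤ) - 1) (by push_cast; omega)]
      rw [show (2 * ((0:ℕ):ℤ) - ((k+1 : ℕ):ℤ) + 1) = 2 * ((0:ℕ):ℤ) - k by push_cast; ring, h1]
      simp [pow_succ]; ring
    · rw [show (2 * ((i+1:ℕ):ℤ) - ((k+1 : ℕ):ℤ) + 1) = 2 * ((i+1:ℕ):ℤ) - k by push_cast; ring,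
        show (2 * ((i+1:ℕ):ℤ) - ((k+1 : ℕ):ℤ) - 1) = 2 * ((i:ℕ):ℤ) - k by push_cast; ring,
        ih, ih, Nat.choose_succ_succ]
      push_cast
      rw [pow_succ]
      field_simp
      ring

theorem centralBinom_sq_le (m : ℕ) : m.centralBinom ^ 2 * (2 * m + 1) ≤ 16 ^ m := by
  induction m with
  | zero => simp
  | succ m ih =>
    have h := Nat.succ_mul_centralBinom_succ m
    set a := m.centralBinom
    set b := (m+1).centralBinom
    have h2 : (m+1)^2 * b^2 = 4 * (2*m+1)^2 * a^2 := by
      rw [← mul_pow, h]; ring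
    have hpos : 0 < (m+1)^2 := by positivity
    refine le_of_mul_le_mul_left (a := (m+1)^2) ?_ hpos
    calc (m+1)^2 * (b^2 * (2*(m+1)+1)) = ((m+1)^2 * b^2) * (2*m+3) := by ring
      _ = (a^2 * (2*m+1)) * (4 * ((2*m+1)*(2*m+3))) := by rw [h2]; ring
      _ ≤ 16^m * (4 * (4 * (m+1)^2)) := by
        refine Nat.mul_le_mul ih (Nat.mul_le_mul_left _ ?_)
        nlinarith
      _ = _ := by ring

theorem srwOne_even_le (q : ℕ) (j : ℤ) : srwOne (2 * q) j ≤ (√(2 * q + 1 : ℝ))⁻¹ := by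
  have hB : (0:ℝ) ≤ (√(2 * q + 1 : ℝ))⁻¹ := by positivity
  rcases Int.emod_two_eq_zero_or_one (j + (2*q:ℕ)) with h | h
  swap
  · rw [srwOne_zero_of_odd _ _ h]; exact hB
  by_cases h0 : j < -((2*q:ℕ):ℤ)
  · rw [srwOne_zero_of_lt _ _ h0]; exact hB
  obtain ⟨i, rfl⟩ : ∃ i : ℕ, j = 2 * i - ((2*q:ℕ):ℤ) :=
    ⟨((j + (2*q:ℕ)) / 2).toNat, by omega⟩
  rw [srwOne_choose]
  have h1 : (2*q).choose i ≤ q.centralBinom := by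
    have := Nat.choose_le_middle i (2*q)
    rwa [Nat.mul_div_cancel_left _ (by norm_num)] at this
  have h2 : ((2*q).choose i : ℝ) ≤ q.centralBinom := by exact_mod_cast h1
  have h3 : ((q.centralBinom : ℝ)) ^ 2 * (2 * q + 1) ≤ 16 ^ q := by
    exact_mod_cast centralBinom_sq_le q
  rw [div_le_iff₀ (by positivity), ← div_eq_inv_mul, le_div_iff₀ (by positivity)]
  refine (mul_le_mul_of_nonneg_right h2 (by positivity)).trans ?_
  refine (pow_le_pow_iff_left₀ (by positivity) (by positivity) two_ne_zero).1 ?_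
  rw [mul_pow, Real.sq_sqrt (by positivity)]
  refine h3.trans (le_of_eq ?_)
  rw [← pow_mul, show 2 * q * 2 = 4 * q by ring, pow_mul]; norm_num

theorem srwOne_le (q k : ℕ) (h : 2 * q ≤ k) (j : ℤ) : srwOne k j ≤ (√(2 * q + 1 : ℝ))⁻¹ := by
  induction k, h using Nat.le_induction generalizing j with
  | base => exact srwOne_even_le q j
  | succ k _ ih =>
    unfold srwOne
    have := ih (j+1); have := ih (j-1); linarith

/-- Kernel of the `d`-dimensional walk given `k i` initial steps in each direction `i`, after `t`
further steps. -/
noncomputable def heatK {d : ℕ} : ℕ → (Fin d → ℕ) → V d → ℝ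
  | 0, k, z => ∏ i, srwOne (k i) (z i)
  | t + 1, k, z => (∑ i : Fin d, heatK t (k + Pi.single i 1) z) / d

theorem nbrAvg_heatK {d : ℕ} (t : ℕ) (k : Fin d → ℕ) (z : V d) :
    nbrAvg (heatK t k) z = heatK (t + 1) k z := by
  induction t generalizing k with
  | zero =>
    rw [nbrAvg_eq, heatK]
    congr 1
    refine Finset.sum_congr rfl fun i _ => ?_
    simp only [heatK]
    rw [← Finset.mul_prod_erase _ _ (Finset.mem_univ i),
      ← Finset.mul_prod_erase _ _ (Finset.mem_univ i),
      ← Finset.mul_prod_erase _ _ (Finset.mem_univ i)]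
    have hE : ∀ c : ℤ, ∏ x ∈ Finset.univ.erase i, srwOne (k x) ((z + Pi.single i c : V d) x) =
        ∏ x ∈ Finset.univ.erase i, srwOne (k x) (z x) := by
      intro c
      refine Finset.prod_congr rfl fun x hx => ?_
      have : x ≠ i := (Finset.mem_erase.1 hx).1
      simp [this]
    have hE' : ∏ x ∈ Finset.univ.erase i, srwOne ((k + Pi.single i 1 : Fin d → ℕ) x) (z x) =
        ∏ x ∈ Finset.univ.erase i, srwOne (k x) (z x) := by
      refine Finset.prod_congr rfl fun x hx => ?_
      have : x ≠ i := (Finset.mem_erase.1 hx).1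
      simp [this]
    rw [hE, hE, hE']
    simp only [Pi.add_apply, Pi.single_eq_same]
    rw [srwOne, sub_eq_add_neg]
    ring
  | succ t ih =>
    rw [heatK]
    simp only [← ih]
    simp only [nbrAvg, heatK, ← Finset.sum_div]
    rw [Finset.sum_comm]
    ring

theorem heatK_zero_sum_le {d : ℕ} (k : Fin d → ℕ) (S : Finset (V d)) (y : V d) :
    ∑ z ∈ S, heatK 0 k (y - z) ≤ 1 := by
  classical
  simp only [heatK]
  set S' : Finset (V d) := S.image (fun z => y - z) with hS'
  have h1 : ∑ z ∈ S, ∏ i, srwOne (k i) ((y - z) i) = ∑ w ∈ S', ∏ i, srwOne (k i) (w i) := by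
    rw [hS', Finset.sum_image]
    intro a _ b _ h
    exact sub_right_injective h
  rw [h1]
  have hsub : S' ⊆ Fintype.piFinset (fun i => S'.image (fun w => w i)) := by
    intro w hw
    rw [Fintype.mem_piFinset]
    exact fun i => Finset.mem_image_of_mem _ hw
  refine (Finset.sum_le_sum_of_subset_of_nonneg hsub fun w _ _ =>
    Finset.prod_nonneg fun i _ => srwOne_nonneg _ _).trans ?_
  rw [← Finset.prod_univ_sum (fun i => S'.image (fun w => w i)) (fun i j => srwOne (k i) j)]
  exact Finset.prod_le_one (fun i _ => Finset.sum_nonneg fun _ _ => srwOne_nonneg _ _)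
    (fun i _ => srwOne_sum_le _ _)

theorem heatK_sum_le {d : ℕ} (hd : 0 < d) (q : ℕ) (S : Finset (V d)) (y : V d) (t : ℕ)
    (k : Fin d → ℕ) :
    ∑ z ∈ S, heatK t k (y - z) ≤ S.card * ((√(2 * q + 1 : ℝ))⁻¹) ^ d +
      (∑ i, 2 ^ (2 * q) * (1 / 2 : ℝ) ^ (k i)) * (1 - 1 / (2 * d)) ^ t := by
  induction t generalizing k with
  | zero =>
    have hnn : ∀ i, (0:ℝ) ≤ 2 ^ (2 * q) * (1 / 2 : ℝ) ^ (k i) := fun i => by positivity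
    rw [pow_zero, mul_one]
    by_cases h : ∀ i, 2 * q ≤ k i
    · have h1 : ∑ z ∈ S, heatK 0 k (y - z) ≤ S.card * ((√(2 * q + 1 : ℝ))⁻¹) ^ d := by
        rw [← nsmul_eq_mul]
        refine Finset.sum_le_card_nsmul _ _ _ fun z _ => ?_
        rw [heatK]
        calc ∏ i, srwOne (k i) ((y - z) i) ≤ ∏ _i : Fin d, (√(2 * q + 1 : ℝ))⁻¹ :=
              Finset.prod_le_prod (fun _ _ => srwOne_nonneg _ _) fun i _ => srwOne_le q _ (h i) _
          _ = _ := by simp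
      have := Finset.sum_nonneg (s := Finset.univ) fun i _ => hnn i
      linarith
    · push Not at h
      obtain ⟨i, hi⟩ := h
      have h1 := heatK_zero_sum_le k S y
      have h2 : (1:ℝ) ≤ 2 ^ (2 * q) * (1 / 2 : ℝ) ^ (k i) := by
        rw [one_div, inv_pow, ← div_eq_mul_inv, le_div_iff₀ (by positivity), one_mul]
        exact pow_le_pow_right₀ (by norm_num) hi.le
      have h3 := Finset.single_le_sum (fun i _ => hnn i) (Finset.mem_univ i)
      have h4 : (0:ℝ) ≤ S.card * ((√(2 * q + 1 : ℝ))⁻¹) ^ d := by positivity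
      linarith
  | succ t ih =>
    simp only [heatK]
    have hd' : (0:ℝ) < d := by exact_mod_cast hd
    rw [← Finset.sum_div, Finset.sum_comm, div_le_iff₀ hd']
    refine (Finset.sum_le_sum fun i _ => ih (k + Pi.single i 1)).trans (le_of_eq ?_)
    rw [Finset.sum_add_distrib, ← Finset.sum_mul, ← Finset.sum_mul]
    have hin : ∀ j : Fin d, ∑ i : Fin d, (2:ℝ) ^ (2 * q) *
        (1/2 : ℝ) ^ ((k + Pi.single i 1 : Fin d → ℕ) j) =
        (2 ^ (2*q) * (1/2:ℝ) ^ (k j)) * (d - 1/2) := by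
      intro j
      have : ∀ i : Fin d, (1/2 : ℝ) ^ ((k + Pi.single i 1 : Fin d → ℕ) j) =
          (1/2:ℝ) ^ (k j) * (1 - if j = i then (1/2) else 0) := by
        intro i
        by_cases hij : j = i
        · subst hij; simp [pow_succ]; ring
        · simp [hij]
      simp only [this, ← Finset.mul_sum, Finset.sum_sub_distrib]
      simp
      ring
    rw [Finset.sum_comm]
    simp only [hin, ← Finset.sum_mul]
    simp only [Finset.sum_const, Finset.card_univ, Fintype.card_fin, nsmul_eq_mul]
    rw [pow_succ]
    field_simp

/-- Squared Euclidean norm. -/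
noncomputable def nsq {d : ℕ} (z : V d) : ℝ := ∑ i, (z i : ℝ) ^ 2

theorem nsq_nonneg {d : ℕ} (z : V d) : 0 ≤ nsq z := Finset.sum_nonneg fun _ _ => sq_nonneg _

theorem nsq_add_single {d : ℕ} (z : V d) (i : Fin d) (c : ℤ) :
    nsq (z + Pi.single i c) = nsq z + 2 * c * z i + c ^ 2 := by
  unfold nsq
  rw [← Finset.add_sum_erase _ _ (Finset.mem_univ i),
    ← Finset.add_sum_erase _ (fun i => (z i : ℝ)^2) (Finset.mem_univ i)]
  have : ∑ x ∈ Finset.univ.erase i, (((z + Pi.single i c : V d) x : ℤ) : ℝ) ^ 2 =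
      ∑ x ∈ Finset.univ.erase i, (z x : ℝ) ^ 2 := by
    refine Finset.sum_congr rfl fun x hx => ?_
    have : x ≠ i := (Finset.mem_erase.1 hx).1
    simp [this]
  rw [this]
  simp
  ring

theorem nbrAvg_nsq {d : ℕ} (hd : 0 < d) (y z : V d) :
    nbrAvg (fun w => nsq (w - y)) z = nsq (z - y) + 1 := by
  have hd' : (0:ℝ) < d := by exact_mod_cast hd
  rw [nbrAvg_eq]
  have : ∀ i : Fin d, (nsq (z + Pi.single i 1 - y) + nsq (z + Pi.single i (-1) - y)) / 2 =
      nsq (z - y) + 1 := by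
    intro i
    rw [add_sub_right_comm, add_sub_right_comm, nsq_add_single, nsq_add_single]
    push_cast; ring
  simp only [this]
  simp
  field_simp

theorem nbrAvg_lin {d : ℕ} (f g : V d → ℝ) (a : ℝ) (z : V d) :
    nbrAvg (fun w => f w + a * g w) z = nbrAvg f z + a * nbrAvg g z := by
  unfold nbrAvg
  rw [Finset.sum_add_distrib, ← Finset.mul_sum]; ring

theorem local_bound {d : ℕ} (hd : 0 < d) (q t : ℕ) (S : Finset (V d)) (y : V d) (r : ℝ)
    (hr : 0 < r) (f : V d → ℝ) (hf1 : ∀ z, f z ≤ 1)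
    (hsub : ∀ z, nsq (z - y) < r ^ 2 → f z ≤ nbrAvg f z)
    (hS : ∀ z, nsq (z - y) < r ^ 2 → z ∉ S → f z ≤ 0) :
    f y ≤ S.card * ((√(2 * q + 1 : ℝ))⁻¹) ^ d + d * 2 ^ (2 * q) * (1 - 1 / (2 * d)) ^ t
      + t / r ^ 2 := by
  have hr2 : 0 < r ^ 2 := by positivity
  have hK0 : ∀ (t : ℕ) (k : Fin d → ℕ) (z : V d), 0 ≤ heatK t k z := by
    intro t
    induction t with
    | zero => intro k z; rw [heatK]; exact Finset.prod_nonneg fun _ _ => srwOne_nonneg _ _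
    | succ t ih =>
      intro k z; rw [heatK]
      exact div_nonneg (Finset.sum_nonneg fun _ _ => ih _ _) (by positivity)
  have hmain : ∀ (t : ℕ) (z : V d), f z ≤
      (∑ w ∈ S, heatK t 0 (z - w) + (t / r^2)) + (1 / r ^ 2) * nsq (z - y) := by
    intro t
    induction t with
    | zero =>
      intro z
      have hs0 : 0 ≤ ∑ w ∈ S, heatK 0 0 (z - w) := Finset.sum_nonneg fun w _ => hK0 0 0 (z - w)
      have hn0 := nsq_nonneg (z - y)
      have hn1 : 0 ≤ (1 / r ^ 2) * nsq (z - y) := by positivity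
      simp only [Nat.cast_zero, zero_div, add_zero]
      by_cases hz : nsq (z - y) < r ^ 2
      · by_cases hzS : z ∈ S
        · have h1 := Finset.single_le_sum (f := fun w => heatK 0 0 (z - w))
            (fun w _ => hK0 0 0 (z - w)) hzS
          have h2 : heatK 0 0 (z - z) = 1 := by simp [heatK, srwOne]
          have := hf1 z
          simp only [h2] at h1
          linarith
        · have := hS z hz hzS
          linarith
      · push Not at hz
        have : 1 ≤ (1 / r ^ 2) * nsq (z - y) := by
          rw [one_div, ← div_eq_inv_mul, le_div_iff₀ hr2, one_mul]; exact hz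
        have := hf1 z
        linarith
    | succ t ih =>
      intro z
      have hs0 : 0 ≤ ∑ w ∈ S, heatK (t+1) 0 (z - w) :=
        Finset.sum_nonneg fun w _ => hK0 (t+1) 0 (z - w)
      by_cases hz : nsq (z - y) < r ^ 2
      · refine (hsub z hz).trans ((nbrAvg_mono ih z).trans (le_of_eq ?_))
        rw [nbrAvg_lin, nbrAvg_nsq hd]
        have e1 : nbrAvg (fun z => ∑ w ∈ S, heatK t 0 (z - w) + (t / r^2)) z =
            ∑ w ∈ S, heatK (t+1) 0 (z - w) + t / r^2 := by
          have h1 := nbrAvg_lin (fun z => ∑ w ∈ S, heatK t 0 (z - w)) (fun _ => 1) (t / r^2) z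
          rw [nbrAvg_const hd] at h1
          simp only [mul_one] at h1
          rw [h1]
          congr 1
          unfold nbrAvg
          rw [Finset.sum_comm, Finset.sum_div]
          refine Finset.sum_congr rfl fun w _ => ?_
          rw [← nbrAvg_heatK, nbrAvg]
          congr 1
          refine Finset.sum_congr rfl fun e _ => ?_
          rw [add_sub_right_comm]
        rw [e1]
        push_cast
        ring
      · push Not at hz
        have : 1 ≤ (1 / r ^ 2) * nsq (z - y) := by
          rw [one_div, ← div_eq_inv_mul, le_div_iff₀ hr2, one_mul]; exact hz
        have := hf1 z
        have : (0:ℝ) ≤ ((t+1:ℕ):ℝ) / r^2 := by positivity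
        linarith
  have h1 := hmain t y
  have h2 := heatK_sum_le hd q S y t 0
  have h3 : nsq (y - y) = 0 := by simp [nsq]
  rw [h3] at h1
  simp only [Pi.zero_apply, pow_zero, mul_one, Finset.sum_const, Finset.card_univ,
    Fintype.card_fin, nsmul_eq_mul] at h2
  linarith


/-! ### Part D: geometry, maximum principle and conclusion -/

/-- Euclidean norm on the lattice. -/
noncomputable def enorm2 {d : ℕ} (z : V d) : ℝ := √(nsq z)

theorem enorm2_eq {d : ℕ} (z : V d) :
    enorm2 z = ‖(WithLp.toLp 2 (fun i => (z i : ℝ)) : EuclideanSpace ℝ (Fin d))‖ := by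
  rw [EuclideanSpace.norm_eq]
  simp [enorm2, nsq]

theorem enorm2_add_le {d : ℕ} (a b : V d) : enorm2 (a + b) ≤ enorm2 a + enorm2 b := by
  simp only [enorm2_eq]
  refine le_trans (le_of_eq ?_) (norm_add_le _ _)
  congr 1
  ext i
  simp

theorem enorm2_neg {d : ℕ} (a : V d) : enorm2 (-a) = enorm2 a := by
  simp [enorm2, nsq]

theorem enorm2_sub_comm {d : ℕ} (a b : V d) : enorm2 (a - b) = enorm2 (b - a) := by
  rw [← enorm2_neg, neg_sub]

theorem enorm2_unit {d : ℕ} {e : V d} (he : e ∈ unitVecs d) : enorm2 e = 1 := by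
  unfold unitVecs at he
  obtain ⟨⟨i, b⟩, _, rfl⟩ := Finset.mem_image.1 he
  unfold enorm2 nsq
  have : ∀ j : Fin d, (((if j = i then (if b then (1:ℤ) else -1) else 0 : ℤ)) : ℝ) ^ 2 =
      if j = i then 1 else 0 := by
    intro j
    split_ifs <;> simp
  simp only [this]
  simp

theorem mem_ball_iff {d : ℕ} (r : ℝ) (y : V d) : y ∈ ball d r ↔ enorm2 y ≤ r := by
  unfold ball
  rw [Finset.mem_filter, Finset.mem_Icc]
  constructor
  · exact fun h => h.2
  · intro h
    refine ⟨?_, h⟩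
    have hi : ∀ i, |(y i : ℝ)| ≤ r := by
      intro i
      refine le_trans ?_ h
      unfold enorm2 nsq
      refine Real.abs_le_sqrt ?_
      exact Finset.single_le_sum (f := fun i => (y i : ℝ)^2) (fun _ _ => sq_nonneg _)
        (Finset.mem_univ i)
    have hc : r ≤ (⌈r⌉ : ℝ) := Int.le_ceil r
    constructor
    · intro i
      have := (abs_le.1 (hi i)).1
      have h2 : ((-⌈r⌉ : ℤ) : ℝ) ≤ (y i : ℝ) := by push_cast; linarith
      exact_mod_cast h2
    · intro i
      have := (abs_le.1 (hi i)).2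
      have h2 : (y i : ℝ) ≤ (⌈r⌉ : ℝ) := by linarith
      exact_mod_cast h2

theorem bn_le (d n : ℕ) : bn d n ≤ (2 * n + 1) ^ d := by
  classical
  unfold bn ball
  refine (Finset.card_filter_le _ _).trans ?_
  rw [Pi.card_Icc]
  simp only [Int.ceil_natCast, Int.card_Icc, Finset.prod_const, Finset.card_univ, Fintype.card_fin]
  refine Nat.pow_le_pow_left ?_ d
  omega

theorem max_principle {d : ℕ} (hd : 0 < d) (D : Finset (V d)) (f : V d → ℝ) (p : ℝ)
    (hsub : ∀ z ∈ D, f z ≤ nbrAvg f z)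
    (hbd : ∀ z ∈ D, ∀ e ∈ unitVecs d, z + e ∉ D → f (z + e) ≤ p) :
    ∀ z ∈ D, f z ≤ p := by
  intro z0 hz0
  by_contra hcon
  push Not at hcon
  obtain ⟨z1, hz1, hmax⟩ := Finset.exists_max_image D f ⟨z0, hz0⟩
  set M := f z1 with hM
  have hMp : p < M := hcon.trans_le (hmax z0 hz0)
  set i0 : Fin d := ⟨0, hd⟩
  obtain ⟨z2, hz2, hmax2⟩ := Finset.exists_max_image (D.filter (fun z => f z = M))
    (fun z => z i0) ⟨z1, by simp [hz1, hM]⟩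
  rw [Finset.mem_filter] at hz2
  have hle : ∀ e ∈ unitVecs d, f (z2 + e) ≤ M := by
    intro e he
    by_cases h : z2 + e ∈ D
    · exact hmax _ h
    · exact (hbd z2 hz2.1 e he h).trans hMp.le
  have heq : ∀ e ∈ unitVecs d, f (z2 + e) = M := by
    have hd' : (0:ℝ) < d := by exact_mod_cast hd
    have h1 := hsub z2 hz2.1
    rw [hz2.2, nbrAvg, le_div_iff₀ (by positivity)] at h1
    have h2 : ∑ e ∈ unitVecs d, M = M * (2 * d) := by
      rw [Finset.sum_const, card_unitVecs]; simp; ring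
    have h3 : ∑ e ∈ unitVecs d, f (z2 + e) = ∑ e ∈ unitVecs d, M :=
      le_antisymm (Finset.sum_le_sum hle) (by rw [h2]; exact h1)
    exact (Finset.sum_eq_sum_iff_of_le hle).1 h3
  set e0 : V d := fun j => if j = i0 then 1 else 0
  have he0 : e0 ∈ unitVecs d := by
    unfold unitVecs
    exact Finset.mem_image.2 ⟨(i0, true), Finset.mem_univ _, by simp [e0]⟩
  have hin : z2 + e0 ∈ D := by
    by_contra h
    have := hbd z2 hz2.1 e0 he0 h
    rw [heq e0 he0] at this
    linarith
  have := hmax2 (z2 + e0) (Finset.mem_filter.2 ⟨hin, heq e0 he0⟩)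
  simp [e0] at this

theorem numeric_bound (d : ℕ) (hd : 0 < d) (p : ℝ) (hp : 0 < p) :
    ∃ ε : ℝ, 0 < ε ∧ ∃ N : ℕ, 4 ≤ N ∧ ∀ n : ℕ, N ≤ n → ∃ q t : ℕ, ∀ s : ℝ,
      0 ≤ s → s ≤ ε * bn d n →
      s * ((√(2 * q + 1 : ℝ))⁻¹) ^ d + d * 2 ^ (2 * q) * (1 - 1 / (2 * d)) ^ t
      + t / ((n:ℝ) / 2 - 1) ^ 2 ≤ p := by
  have hd' : (1:ℝ) ≤ d := by exact_mod_cast hd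
  set c : ℝ := p / (768 * d) with hc
  have hcpos : 0 < c := by positivity
  have hsc : 0 < √c := Real.sqrt_pos.2 hcpos
  refine ⟨(p / 3) * (√c / 3) ^ d, by positivity,
    ⌈1152 * d ^ 2 / p ^ 2⌉₊ + ⌈96 / p⌉₊ + 4, by omega, ?_⟩
  intro n hn
  have hn4 : (4:ℝ) ≤ n := by
    have : 4 ≤ n := by omega
    exact_mod_cast this
  have hnn : (n:ℝ) ≤ (n:ℝ)^2 := by nlinarith
  have hn1 : 1152 * d ^ 2 / p ^ 2 ≤ (n:ℝ)^2 := by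
    refine le_trans (Nat.le_ceil _) (le_trans ?_ hnn)
    exact_mod_cast (by omega : ⌈1152 * (d:ℝ) ^ 2 / p ^ 2⌉₊ ≤ n)
  have hn2 : 96 / p ≤ (n:ℝ)^2 := by
    refine le_trans (Nat.le_ceil _) (le_trans ?_ hnn)
    exact_mod_cast (by omega : ⌈96 / p⌉₊ ≤ n)
  rw [div_le_iff₀ (by positivity)] at hn1 hn2
  set t : ℕ := ⌊p * (n:ℝ)^2 / 48⌋₊ with ht
  have ht1 : (t:ℝ) ≤ p * (n:ℝ)^2 / 48 := Nat.floor_le (by positivity)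
  have ht2 : p * (n:ℝ)^2 / 96 ≤ t := by
    have := Nat.lt_floor_add_one (p * (n:ℝ)^2 / 48)
    rw [← ht] at this
    linarith
  have htpos : (0:ℝ) < t := lt_of_lt_of_le (by positivity) ht2
  set q : ℕ := t / (8 * d) with hq
  have hq1 : (8 * d * q : ℝ) ≤ t := by
    have : 8 * d * q ≤ t := Nat.mul_div_le t (8*d)
    exact_mod_cast this
  have hq2 : (t:ℝ) ≤ 8 * d * (2 * q + 1) := by
    have h : t < 8 * d * (q + 1) := Nat.lt_mul_div_succ t (by omega)
    have h' : (t:ℝ) < 8 * d * (q + 1) := by exact_mod_cast h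
    have : (0:ℝ) ≤ 8 * d * q := by positivity
    nlinarith
  refine ⟨q, t, fun s hs0 hs => ?_⟩
  -- first term
  have hb : (bn d n : ℝ) ≤ (3 * n) ^ d := by
    have h1 : (bn d n : ℝ) ≤ (2 * n + 1) ^ d := by exact_mod_cast bn_le d n
    refine h1.trans (pow_le_pow_left₀ (by positivity) (by linarith) d)
  have hsq : √c * n ≤ √(2 * q + 1 : ℝ) := by
    refine Real.le_sqrt_of_sq_le ?_
    rw [mul_pow, Real.sq_sqrt hcpos.le, hc]
    rw [div_mul_eq_mul_div, div_le_iff₀ (by positivity)]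
    nlinarith
  have hn0 : (0:ℝ) < n := by linarith
  have T1 : s * ((√(2 * q + 1 : ℝ))⁻¹) ^ d ≤ p / 3 := by
    calc s * ((√(2 * q + 1 : ℝ))⁻¹) ^ d
        ≤ ((p / 3) * (√c / 3) ^ d * (3 * n) ^ d) * ((√c * n)⁻¹) ^ d := by
          refine mul_le_mul (hs.trans (mul_le_mul_of_nonneg_left hb (by positivity))) ?_
            (by positivity) (by positivity)
          refine pow_le_pow_left₀ (by positivity) ?_ d
          exact inv_anti₀ (by positivity) hsq
      _ = p / 3 := by
          rw [mul_assoc, mul_assoc, ← mul_pow, ← mul_pow]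
          rw [show √c / 3 * (3 * n * (√c * n)⁻¹) = 1 by field_simp]
          simp
  -- second term
  have T2 : d * 2 ^ (2 * q) * (1 - 1 / (2 * d)) ^ t ≤ p / 3 := by
    have h1 : (2:ℝ) ^ (2 * q) ≤ Real.exp (t / (4 * d)) := by
      have : (2:ℝ) ≤ Real.exp 1 := by have := Real.add_one_le_exp (1:ℝ); linarith
      refine (pow_le_pow_left₀ (by norm_num) this _).trans ?_
      rw [← Real.exp_nat_mul]
      refine Real.exp_le_exp.2 ?_
      rw [le_div_iff₀ (by positivity)]
      push_cast
      linarith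
    have h2 : (1 - 1 / (2 * d) : ℝ) ^ t ≤ Real.exp (- (t / (2 * d))) := by
      have h0 : 0 ≤ (1 - 1 / (2 * d) : ℝ) := by
        have : 1 / (2 * d) ≤ (1:ℝ) := by rw [div_le_one (by positivity)]; linarith
        linarith
      have := Real.one_sub_le_exp_neg (1 / (2 * d) : ℝ)
      refine (pow_le_pow_left₀ h0 this t).trans ?_
      rw [← Real.exp_nat_mul]
      refine Real.exp_le_exp.2 (le_of_eq ?_)
      ring
    have h3 : (2:ℝ) ^ (2 * q) * (1 - 1 / (2 * d)) ^ t ≤ Real.exp (-(t / (4 * d))) := by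
      have h0 : 0 ≤ (1 - 1 / (2 * d) : ℝ) := by
        have : 1 / (2 * d) ≤ (1:ℝ) := by rw [div_le_one (by positivity)]; linarith
        linarith
      refine (mul_le_mul h1 h2 (pow_nonneg h0 t) (Real.exp_pos _).le).trans ?_
      rw [← Real.exp_add]
      refine Real.exp_le_exp.2 (le_of_eq ?_)
      field_simp
      ring
    have h4 : Real.exp (-(t / (4 * d) : ℝ)) ≤ (4 * d) / t := by
      rw [Real.exp_neg]
      have := Real.add_one_le_exp (t / (4 * d) : ℝ)
      have e : (4 * d : ℝ) / t = ((t : ℝ) / (4 * d))⁻¹ := by rw [inv_div]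
      rw [e]
      have hpos : (0 : ℝ) < (t : ℝ) / (4 * d) := by positivity
      exact inv_anti₀ hpos (by linarith)
    rw [mul_assoc]
    refine (mul_le_mul_of_nonneg_left (h3.trans h4) (by positivity)).trans ?_
    rw [← mul_div_assoc, div_le_iff₀ htpos]
    have h5 : p * (p * (n:ℝ)^2 / 96) ≤ p * t := mul_le_mul_of_nonneg_left ht2 hp.le
    nlinarith
  -- third term
  have T3 : (t:ℝ) / ((n:ℝ) / 2 - 1) ^ 2 ≤ p / 3 := by
    have h1 : (n:ℝ) / 4 ≤ (n:ℝ) / 2 - 1 := by linarith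
    have h2 : ((n:ℝ) / 4) ^ 2 ≤ ((n:ℝ) / 2 - 1) ^ 2 := pow_le_pow_left₀ (by positivity) h1 2
    rw [div_le_iff₀ (lt_of_lt_of_le (by positivity) h2)]
    nlinarith
  linarith

theorem statement6 (d : ℕ) (hd : 2 ≤ d) (p : ℝ) (hp : 0 < p) :
    ∃ ε : ℝ, 0 < ε ∧ ∃ N : ℕ, ∀ n m : ℕ, N ≤ n → N ≤ m →
      ∀ x ∈ ball d m, ∀ S : Finset (V d), S ⊆ ball d ((m : ℝ) + n) →
        (S.card : ℝ) ≤ ε * bn d n →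
        μ0 {ω | hitPt (S ∪ ball d m) x ω ∈ outb (ball d ((m : ℝ) + n))} ≤
          ENNReal.ofReal p := by
  have hd0 : 0 < d := by omega
  obtain ⟨ε, hε, N, hN4, hN⟩ := numeric_bound d hd0 p hp
  refine ⟨ε, hε, N, fun n m hn _ x hx S hS hcard => ?_⟩
  obtain ⟨q, t, hqt⟩ := hN n hn
  have hn4 : (4:ℝ) ≤ n := by
    have : 4 ≤ n := by omega
    exact_mod_cast this
  have hnum := hqt S.card (by positivity) hcard
  have houtb : ∀ z : V d, enorm2 z ≤ (m:ℝ) + n → z ∉ outb (ball d ((m : ℝ) + n)) := by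
    intro z hz h
    unfold outb at h
    exact (Finset.mem_sdiff.1 h).2 ((mem_ball_iff _ _).2 hz)
  have hxm : enorm2 x ≤ m := (mem_ball_iff _ _).1 hx
  refine prob_le_of_hitQ hd0 _ _ x p (houtb x (by linarith)) fun T => ?_
  set f := hitQ (S ∪ ball d m) (outb (ball d ((m : ℝ) + n))) T with hf
  have hsub : ∀ z : V d, enorm2 z ≤ (m:ℝ) + n → f z ≤ nbrAvg f z := fun z hz =>
    hitQ_subharm _ _ T z (houtb z hz)
  refine max_principle hd0 (ball d ((m:ℝ) + n / 2)) f p ?_ ?_ x ?_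
  · intro z hz
    have := (mem_ball_iff _ _).1 hz
    exact hsub z (by linarith)
  · intro z hz e he hze
    have hz' := (mem_ball_iff _ _).1 hz
    rw [mem_ball_iff] at hze
    push Not at hze
    have hub := enorm2_add_le z e
    rw [enorm2_unit he] at hub
    set y := z + e
    have hr : (0:ℝ) < (n:ℝ) / 2 - 1 := by linarith
    have hlt : ∀ w : V d, nsq (w - y) < ((n:ℝ)/2 - 1)^2 → enorm2 (w - y) < (n:ℝ)/2 - 1 := by
      intro w hw
      unfold enorm2
      rw [Real.sqrt_lt' hr]; exact hw
    refine (local_bound hd0 q t S y ((n:ℝ)/2 - 1) hr f (fun w => hitQ_le_one hd0 _ _ T w)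
      ?_ ?_).trans hnum
    · intro w hw
      have h1 := hlt w hw
      have h2 := enorm2_add_le (w - y) y
      rw [sub_add_cancel] at h2
      exact hsub w (by linarith)
    · intro w hw hwS
      have h1 := hlt w hw
      have h2 := enorm2_add_le (w - y) y
      rw [sub_add_cancel] at h2
      have h3 := enorm2_add_le (y - w) w
      rw [sub_add_cancel, enorm2_sub_comm y w] at h3
      have hA : w ∉ S ∪ ball d m := by
        rw [Finset.mem_union, not_or, mem_ball_iff]
        exact ⟨hwS, by push Not; linarith⟩
      exact (hitQ_of_not_mem _ _ T w hA (houtb w (by linarith))).le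
  · rw [mem_ball_iff]; linarith
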